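/- arXiv:1509.02088 — 4 statements merged into one kernel-verified Lean document; each statement's English description precedes it below -/
import Mathlib

section
/- (Proposition 1: posterior mean update in matrix form.) Let C be a real m×r matrix, V a real r×r matrix, x a real r-vector, y a real m-vector, and λ a real number with xᵀVx + λ ≠ 0. Set c = vec(C), P = V ⊗ I_m, H = xᵀ ⊗ I_m, and R = λ·I_m. Then the vector c + P Hᵀ (H P Hᵀ + R)⁻¹ (y − H c) equals vec( C + (1/(xᵀVx + λ)) · (y − Cx) xᵀ Vᵀ ), where (y − Cx) xᵀ Vᵀ is the m×r matrix given by the outer product of y − Cx with x, multiplied on the right by Vᵀ. -/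
open Matrix Kronecker

/-- The row-vector form of a quadratic form, as a scalar multiple of the `1 × 1` identity. -/
theorem replicateRow_mul_mul_transpose {n R : Type*} [Fintype n] [CommSemiring R]
    (V : Matrix n n R) (x : n → R) :
    replicateRow (Fin 1) x * V * (replicateRow (Fin 1) x)ᵀ =
      (x ⬝ᵥ V.mulVec x) • (1 : Matrix (Fin 1) (Fin 1) R) := by
  ext i j
  rw [Subsingleton.elim j i, Matrix.mul_assoc, transpose_replicateRow, ← replicateCol_mulVec]
  simp [Matrix.mul_apply, dotProduct]

/-- Proposition 1: posterior mean update in matrix form.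
With `c = vec C`, `P = V ⊗ I_m`, `H = xᵀ ⊗ I_m`, `R = λ·I_m` and
`xᵀ V x + λ ≠ 0`, the recursive-filter mean update
`c + P Hᵀ (H P Hᵀ + R)⁻¹ (y − H c)` equals
`vec (C + (1/(xᵀ V x + λ)) • (y − C x) xᵀ Vᵀ)`. -/
theorem posterior_mean_update_matrix_form
    (m r : ℕ) (C : Matrix (Fin m) (Fin r) ℝ) (V : Matrix (Fin r) (Fin r) ℝ)
    (x : Fin r → ℝ) (y : Fin m → ℝ) (lam : ℝ)
    (hx : x ⬝ᵥ V.mulVec x + lam ≠ 0) :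
    (let c : Fin r × Fin m → ℝ := fun p => C p.2 p.1
     let P : Matrix (Fin r × Fin m) (Fin r × Fin m) ℝ :=
       V ⊗ₖ (1 : Matrix (Fin m) (Fin m) ℝ)
     let H : Matrix (Fin 1 × Fin m) (Fin r × Fin m) ℝ :=
       (Matrix.of fun (_ : Fin 1) (j : Fin r) => x j) ⊗ₖ
         (1 : Matrix (Fin m) (Fin m) ℝ)
     let R : Matrix (Fin 1 × Fin m) (Fin 1 × Fin m) ℝ := lam • 1
     c + (P * Hᵀ * (H * P * Hᵀ + R)⁻¹).mulVec
           ((fun q : Fin 1 × Fin m => y q.2) - H.mulVec c))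
    = fun p : Fin r × Fin m =>
        (C + (x ⬝ᵥ V.mulVec x + lam)⁻¹ •
            (Matrix.vecMulVec (y - C.mulVec x) x * Vᵀ)) p.2 p.1 := by
  have hinv : ((replicateRow (Fin 1) x ⊗ₖ (1 : Matrix (Fin m) (Fin m) ℝ)) *
      (V ⊗ₖ (1 : Matrix (Fin m) (Fin m) ℝ)) *
      (replicateRow (Fin 1) x ⊗ₖ (1 : Matrix (Fin m) (Fin m) ℝ))ᵀ +
        lam • (1 : Matrix (Fin 1 × Fin m) (Fin 1 × Fin m) ℝ))⁻¹ =
      (x ⬝ᵥ V.mulVec x + lam)⁻¹ • 1 := by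
    rw [← kroneckerMap_transpose, ← mul_kronecker_mul, transpose_one,
      ← mul_kronecker_mul, replicateRow_mul_mul_transpose, smul_kronecker, Matrix.one_mul,
      Matrix.one_mul, one_kronecker_one, ← add_smul]
    refine Matrix.inv_eq_right_inv ?_
    rw [Matrix.smul_mul, Matrix.one_mul, smul_smul, mul_inv_cancel₀ hx, one_smul]
  change vec C + ((V ⊗ₖ (1 : Matrix (Fin m) (Fin m) ℝ)) *
      (replicateRow (Fin 1) x ⊗ₖ (1 : Matrix (Fin m) (Fin m) ℝ))ᵀ *
      ((replicateRow (Fin 1) x ⊗ₖ (1 : Matrix (Fin m) (Fin m) ℝ)) *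
        (V ⊗ₖ (1 : Matrix (Fin m) (Fin m) ℝ)) *
        (replicateRow (Fin 1) x ⊗ₖ (1 : Matrix (Fin m) (Fin m) ℝ))ᵀ + lam • 1)⁻¹).mulVec
      (vec (replicateCol (Fin 1) y) -
        (replicateRow (Fin 1) x ⊗ₖ (1 : Matrix (Fin m) (Fin m) ℝ)).mulVec (vec C)) =
    vec (C + (x ⬝ᵥ V.mulVec x + lam)⁻¹ • (vecMulVec (y - C.mulVec x) x * Vᵀ))
  have hres : replicateCol (Fin 1) y - C * replicateCol (Fin 1) x =
      replicateCol (Fin 1) (y - C.mulVec x) := by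
    rw [← replicateCol_mulVec]
    rfl
  have hout : replicateCol (Fin 1) (y - C.mulVec x) * replicateRow (Fin 1) x =
      vecMulVec (y - C.mulVec x) x := by
    ext i j
    simp [Matrix.mul_apply, vecMulVec_apply]
  rw [hinv, kronecker_mulVec_vec, Matrix.one_mul, transpose_replicateRow, ← vec_sub, hres,
    Matrix.mul_smul, Matrix.mul_one, smul_mulVec, ← kroneckerMap_transpose,
    ← mul_kronecker_mul, transpose_one, Matrix.one_mul, kronecker_mulVec_vec, Matrix.one_mul,
    transpose_mul, transpose_transpose, ← Matrix.mul_assoc, hout, vec_add,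
    vec_smul]
end

section
/- (Proposition 2: posterior covariance update in matrix form.) Let V be a real r×r matrix, x a real r-vector, and λ a real number with xᵀVx + λ ≠ 0. Set P = V ⊗ I_m, H = xᵀ ⊗ I_m, and R = λ·I_m. Then P − P Hᵀ (H P Hᵀ + R)⁻¹ H P = ( V − (1/(xᵀVx + λ)) · V x xᵀ V ) ⊗ I_m, where V x xᵀ V denotes the r×r matrix (V x)(xᵀ V). -/
open Matrix Kronecker

/-- Proposition 2: posterior covariance update in matrix form.
With `P = V ⊗ I_m`, `H = xᵀ ⊗ I_m`, `R = λ·I_m` and `xᵀ V x + λ ≠ 0`,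
`P − P Hᵀ (H P Hᵀ + R)⁻¹ H P = (V − (1/(xᵀ V x + λ)) (V x)(xᵀ V)) ⊗ I_m`. -/
theorem posterior_covariance_update_matrix_form
    (m r : ℕ) (V : Matrix (Fin r) (Fin r) ℝ) (x : Fin r → ℝ) (lam : ℝ)
    (hx : x ⬝ᵥ V.mulVec x + lam ≠ 0) :
    (let P : Matrix (Fin r × Fin m) (Fin r × Fin m) ℝ :=
       V ⊗ₖ (1 : Matrix (Fin m) (Fin m) ℝ)
     let H : Matrix (Fin 1 × Fin m) (Fin r × Fin m) ℝ :=
       (Matrix.of fun (_ : Fin 1) (j : Fin r) => x j) ⊗ₖ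
         (1 : Matrix (Fin m) (Fin m) ℝ)
     let R : Matrix (Fin 1 × Fin m) (Fin 1 × Fin m) ℝ := lam • 1
     P - P * Hᵀ * (H * P * Hᵀ + R)⁻¹ * H * P)
    = (V - (x ⬝ᵥ V.mulVec x + lam)⁻¹ •
          Matrix.vecMulVec (V.mulVec x) (Matrix.vecMul x V)) ⊗ₖ
        (1 : Matrix (Fin m) (Fin m) ℝ) := by
  extract_lets P H R
  set X : Matrix (Fin 1) (Fin r) ℝ := Matrix.of fun _ j => x j with hX
  set s := x ⬝ᵥ V.mulVec x + lam
  have hH : H = X ⊗ₖ (1 : Matrix (Fin m) (Fin m) ℝ) := rfl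
  have hT : Hᵀ = Xᵀ ⊗ₖ (1 : Matrix (Fin m) (Fin m) ℝ) := by
    rw [hH, ← kroneckerMap_transpose, transpose_one]
  have hXVX : X * V * Xᵀ = (x ⬝ᵥ V.mulVec x) • (1 : Matrix (Fin 1) (Fin 1) ℝ) := by
    ext i j
    rw [Subsingleton.elim i j, Matrix.mul_assoc]
    simp [hX, Matrix.mul_apply, dotProduct, mulVec]
  have hS : H * P * Hᵀ + R = s • 1 := by
    rw [hT, hH]
    simp only [P, R, ← mul_kronecker_mul, Matrix.mul_one]
    rw [hXVX, smul_kronecker, one_kronecker_one, ← add_smul]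
  have hInv : (H * P * Hᵀ + R)⁻¹ = s⁻¹ • 1 := by
    rw [hS]
    apply Matrix.inv_eq_right_inv
    rw [Matrix.smul_mul, Matrix.one_mul, smul_smul, mul_inv_cancel₀ hx, one_smul]
  have hOuter : V * Xᵀ * X * V = vecMulVec (V.mulVec x) (vecMul x V) := by
    rw [Matrix.mul_assoc (V * Xᵀ)]
    ext i j
    simp [hX, Matrix.mul_apply, vecMulVec_apply, mulVec, vecMul, dotProduct]
  rw [hInv, hT, hH, Matrix.mul_smul, Matrix.mul_one, Matrix.smul_mul, Matrix.smul_mul]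
  simp only [P, ← mul_kronecker_mul, Matrix.mul_one]
  rw [hOuter, ← smul_kronecker]
  ext ⟨i, k⟩ ⟨j, l⟩
  simp only [Matrix.sub_apply, kroneckerMap_apply, sub_mul]
end

section
/- (Kronecker structure is preserved by the filter recursion.) Let λ be a real number, let (x_k)_{k≥1} be a sequence of real r-vectors, and define H_k = x_kᵀ ⊗ I_m and R = λ·I_m. Let V_0 be a real r×r matrix and define V_k = V_{k−1} − (1/(x_kᵀ V_{k−1} x_k + λ)) · (V_{k−1} x_k)(x_kᵀ V_{k−1}) for k ≥ 1, and let P_0 = V_0 ⊗ I_m with P_k = P_{k−1} − P_{k−1} H_kᵀ (H_k P_{k−1} H_kᵀ + R)⁻¹ H_k P_{k−1} for k ≥ 1. If x_kᵀ V_{k−1} x_k + λ ≠ 0 for all k ≥ 1, then P_k = V_k ⊗ I_m for every k ≥ 0. -/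
open Matrix Kronecker

/-- The `m × mr` observation matrix `H = vᵀ ⊗ I_m` built from a vector `v`. -/
def obsMat (m r : ℕ) (v : Fin r → ℝ) :
    Matrix (Fin 1 × Fin m) (Fin r × Fin m) ℝ :=
  (Matrix.of fun (_ : Fin 1) (j : Fin r) => v j) ⊗ₖ
    (1 : Matrix (Fin m) (Fin m) ℝ)

/-- The innovation matrix `H (A ⊗ I_m) Hᵀ + λ I` is the scalar matrix `vᵀ A v + λ`. -/
theorem obsMat_innovation_eq (m r : ℕ) (lam : ℝ) (v : Fin r → ℝ) (A : Matrix (Fin r) (Fin r) ℝ) :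
    obsMat m r v * A ⊗ₖ (1 : Matrix (Fin m) (Fin m) ℝ) * (obsMat m r v)ᵀ +
        lam • (1 : Matrix (Fin 1 × Fin m) (Fin 1 × Fin m) ℝ) =
      (v ⬝ᵥ A.mulVec v + lam) • (1 : Matrix (Fin 1 × Fin m) (Fin 1 × Fin m) ℝ) := by
  have h : replicateRow (Fin 1) v * A * (replicateRow (Fin 1) v)ᵀ =
      (v ⬝ᵥ A.mulVec v) • (1 : Matrix (Fin 1) (Fin 1) ℝ) := by
    ext i j
    rw [Subsingleton.elim i j, Matrix.mul_assoc]
    simp [Matrix.mul_apply, dotProduct, mulVec]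
  change replicateRow (Fin 1) v ⊗ₖ (1 : Matrix (Fin m) (Fin m) ℝ) * _ *
    (replicateRow (Fin 1) v ⊗ₖ (1 : Matrix (Fin m) (Fin m) ℝ))ᵀ + _ = _
  rw [← kroneckerMap_transpose, transpose_one, ← mul_kronecker_mul, ← mul_kronecker_mul, h,
    Matrix.mul_one, Matrix.mul_one, smul_kronecker, one_kronecker_one, add_smul]

/-- The gain part `(A ⊗ I_m) Hᵀ H (A ⊗ I_m)` of the filter update is `(A v)(vᵀ A) ⊗ I_m`. -/
theorem kronecker_mul_obsMat_gram (m r : ℕ) (v : Fin r → ℝ) (A : Matrix (Fin r) (Fin r) ℝ) :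
    A ⊗ₖ (1 : Matrix (Fin m) (Fin m) ℝ) * (obsMat m r v)ᵀ * obsMat m r v *
        A ⊗ₖ (1 : Matrix (Fin m) (Fin m) ℝ) =
      vecMulVec (A.mulVec v) (vecMul v A) ⊗ₖ (1 : Matrix (Fin m) (Fin m) ℝ) := by
  have h : A * (replicateRow (Fin 1) v)ᵀ * replicateRow (Fin 1) v * A =
      vecMulVec (A.mulVec v) (vecMul v A) := by
    rw [Matrix.mul_assoc]
    ext i j
    simp [Matrix.mul_apply, vecMulVec_apply, mulVec, vecMul, dotProduct]
  change _ * (replicateRow (Fin 1) v ⊗ₖ (1 : Matrix (Fin m) (Fin m) ℝ))ᵀ *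
    replicateRow (Fin 1) v ⊗ₖ (1 : Matrix (Fin m) (Fin m) ℝ) * _ = _
  rw [← kroneckerMap_transpose, transpose_one, ← mul_kronecker_mul, ← mul_kronecker_mul,
    ← mul_kronecker_mul, h, Matrix.mul_one, Matrix.mul_one, Matrix.mul_one]

/-- Kronecker structure is preserved by the filter recursion.
If `P 0 = V 0 ⊗ I_m`, `V` follows the matrix-variate covariance recursion,
`P` follows the recursive-filter covariance recursion with `H k = x kᵀ ⊗ I_m`
and `R = λ·I_m`, and `x kᵀ V (k−1) x k + λ ≠ 0` for all `k ≥ 1`, then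
`P k = V k ⊗ I_m` for every `k`. -/
theorem kronecker_structure_preserved
    (m r : ℕ) (lam : ℝ) (x : ℕ → Fin r → ℝ)
    (V : ℕ → Matrix (Fin r) (Fin r) ℝ)
    (P : ℕ → Matrix (Fin r × Fin m) (Fin r × Fin m) ℝ)
    (hV : ∀ k : ℕ,
      V (k + 1) = V k - (x (k + 1) ⬝ᵥ (V k).mulVec (x (k + 1)) + lam)⁻¹ •
        Matrix.vecMulVec ((V k).mulVec (x (k + 1)))
          (Matrix.vecMul (x (k + 1)) (V k)))
    (hP0 : P 0 = V 0 ⊗ₖ (1 : Matrix (Fin m) (Fin m) ℝ))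
    (hP : ∀ k : ℕ,
      P (k + 1) = P k - P k * (obsMat m r (x (k + 1)))ᵀ *
        (obsMat m r (x (k + 1)) * P k * (obsMat m r (x (k + 1)))ᵀ +
            lam • (1 : Matrix (Fin 1 × Fin m) (Fin 1 × Fin m) ℝ))⁻¹ *
        obsMat m r (x (k + 1)) * P k)
    (hnz : ∀ k : ℕ, x (k + 1) ⬝ᵥ (V k).mulVec (x (k + 1)) + lam ≠ 0) :
    ∀ k : ℕ, P k = V k ⊗ₖ (1 : Matrix (Fin m) (Fin m) ℝ) := by
  intro k
  induction k with
  | zero => exact hP0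
  | succ k ih =>
    have hinv : ((x (k + 1) ⬝ᵥ (V k).mulVec (x (k + 1)) + lam) •
        (1 : Matrix (Fin 1 × Fin m) (Fin 1 × Fin m) ℝ))⁻¹ =
        (x (k + 1) ⬝ᵥ (V k).mulVec (x (k + 1)) + lam)⁻¹ • 1 :=
      Matrix.inv_eq_right_inv (by simp [smul_smul, hnz k])
    rw [hP, hV, ih, obsMat_innovation_eq, hinv, Matrix.mul_smul, Matrix.mul_one,
      Matrix.smul_mul, Matrix.smul_mul, kronecker_mul_obsMat_gram, ← smul_kronecker]
    ext ⟨i, a⟩ ⟨j, b⟩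
    simp [sub_mul]
end

section
/- (Recovery of Broyden's rule.) Let C be a real m×r matrix, x a real r-vector, y a real m-vector, and λ a real number with xᵀx + λ ≠ 0. Set c = vec(C), P = I_{mr} (the mr×mr identity), H = xᵀ ⊗ I_m, and R = λ·I_m. Then c + P Hᵀ (H P Hᵀ + R)⁻¹ (y − H c) = vec( C + (1/(xᵀx + λ)) · (y − Cx) xᵀ ), where (y − Cx) xᵀ is the m×r outer product of y − Cx with x. -/
open Matrix Kronecker

namespace Matrix

variable {ι m r α : Type*} [DecidableEq m]

theorem replicateRow_kronecker_one_mul_transpose [Fintype m] [Fintype r] [DecidableEq ι]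
    [Subsingleton ι] [CommSemiring α] (x : r → α) :
    (replicateRow ι x ⊗ₖ (1 : Matrix m m α)) * (replicateRow ι x ⊗ₖ (1 : Matrix m m α))ᵀ =
      (x ⬝ᵥ x) • (1 : Matrix (ι × m) (ι × m) α) := by
  have hrow : replicateRow ι x * (replicateRow ι x)ᵀ = (x ⬝ᵥ x) • (1 : Matrix ι ι α) := by
    ext i j
    obtain rfl := Subsingleton.elim i j
    simp [mul_apply, dotProduct]
  rw [← kroneckerMap_transpose, transpose_one, ← mul_kronecker_mul, hrow, Matrix.mul_one,
    smul_kronecker, one_kronecker_one]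

theorem replicateRow_kronecker_one_mulVec_vec [Fintype m] [Fintype r] [CommSemiring α]
    (C : Matrix m r α) (x : r → α) :
    (replicateRow ι x ⊗ₖ (1 : Matrix m m α)) *ᵥ vec C = fun q => (C *ᵥ x) q.2 := by
  rw [kronecker_mulVec_vec, Matrix.one_mul]
  rfl

theorem replicateRow_kronecker_one_transpose_mulVec [Fintype m] [Unique ι] [CommSemiring α]
    (x : r → α) (v : m → α) :
    (replicateRow ι x ⊗ₖ (1 : Matrix m m α))ᵀ *ᵥ (fun q => v q.2) = vec (vecMulVec v x) := by
  have hv : (fun q : ι × m => v q.2) = vec (replicateCol ι v) := rfl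
  rw [hv, ← kroneckerMap_transpose, transpose_one, kronecker_mulVec_vec, Matrix.one_mul,
    transpose_transpose, vecMulVec_eq ι]

end Matrix

/-- Recovery of Broyden's rule. With `c = vec C`, `P = I_{mr}`,
`H = xᵀ ⊗ I_m`, `R = λ·I_m` and `xᵀ x + λ ≠ 0`,
`c + P Hᵀ (H P Hᵀ + R)⁻¹ (y − H c) = vec (C + (1/(xᵀ x + λ)) (y − C x) xᵀ)`. -/
theorem broyden_rule_recovery
    (m r : ℕ) (C : Matrix (Fin m) (Fin r) ℝ) (x : Fin r → ℝ) (y : Fin m → ℝ)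
    (lam : ℝ) (hx : x ⬝ᵥ x + lam ≠ 0) :
    (let c : Fin r × Fin m → ℝ := fun p => C p.2 p.1
     let P : Matrix (Fin r × Fin m) (Fin r × Fin m) ℝ := 1
     let H : Matrix (Fin 1 × Fin m) (Fin r × Fin m) ℝ :=
       (Matrix.of fun (_ : Fin 1) (j : Fin r) => x j) ⊗ₖ
         (1 : Matrix (Fin m) (Fin m) ℝ)
     let R : Matrix (Fin 1 × Fin m) (Fin 1 × Fin m) ℝ := lam • 1
     c + (P * Hᵀ * (H * P * Hᵀ + R)⁻¹).mulVec
           ((fun q : Fin 1 × Fin m => y q.2) - H.mulVec c))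
    = fun p : Fin r × Fin m =>
        (C + (x ⬝ᵥ x + lam)⁻¹ • Matrix.vecMulVec (y - C.mulVec x) x) p.2 p.1 := by
  extract_lets c P H R
  have hS : (H * P * Hᵀ + R)⁻¹ = (x ⬝ᵥ x + lam)⁻¹ • 1 := by
    have hH : H * Hᵀ = (x ⬝ᵥ x) • 1 := replicateRow_kronecker_one_mul_transpose x
    rw [show H * P = H from Matrix.mul_one H, hH, ← add_smul]
    apply inv_eq_right_inv
    rw [smul_mul_smul_comm, mul_inv_cancel₀ hx, one_smul, Matrix.mul_one]
  have hc : H.mulVec c = fun q => (C *ᵥ x) q.2 := replicateRow_kronecker_one_mulVec_vec C x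
  have hv : Hᵀ *ᵥ ((fun q : Fin 1 × Fin m => y q.2) - H.mulVec c) =
      vec (vecMulVec (y - C *ᵥ x) x) := by
    rw [hc]
    exact replicateRow_kronecker_one_transpose_mulVec x (y - C *ᵥ x)
  rw [hS, show P * Hᵀ = Hᵀ from Matrix.one_mul Hᵀ, Matrix.mul_smul, Matrix.mul_one,
    smul_mulVec, hv]
  rfl
end
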